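/- arXiv:math/0511728 — 2 statements merged into one kernel-verified Lean document; each statement's English description precedes it below -/
import Mathlib

section
/- Let X be a normal locally noetherian scheme, U an open subscheme whose complement Z = X ∖ U has everywhere codimension at least 2 in X, and i : U → X the inclusion. Then the canonical morphism O_X → i_*O_U is an isomorphism; equivalently, for every open V ⊆ X, the restriction map O_X(V) → O_U(U ∩ V) is bijective, i.e., every regular function on U ∩ V extends uniquely to a regular function on V. -/
open AlgebraicGeometry CategoryTheory TopologicalSpace

universe u

/-- The closed subset `T` of the topological space `S` has codimension at least two:
below every irreducible closed subset contained in `T` there is a strictly increasing chain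
of length two of irreducible closed subsets of `S`. -/
def codimAtLeastTwo (S : Type*) [TopologicalSpace S] (T : Set S) : Prop :=
  ∀ C : TopologicalSpace.IrreducibleCloseds S, (C : Set S) ⊆ T → 2 ≤ Order.coheight C

/-- The subset `Z` of the topological space `X` has everywhere codimension at least two:
for every irreducible component `Y` of `X`, the codimension of `Z ∩ Y` in `Y` is at
least two. -/
def hasEverywhereCodimAtLeastTwo {X : Type*} [TopologicalSpace X] (Z : Set X) : Prop :=
  ∀ Y ∈ irreducibleComponents X, codimAtLeastTwo Y (Subtype.val ⁻¹' Z)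

/-- A scheme is normal if all of its local rings are integrally closed domains. -/
def IsNormalScheme (X : Scheme) : Prop :=
  ∀ x : X, IsDomain (X.presheaf.stalk x) ∧ IsIntegrallyClosed (X.presheaf.stalk x)

theorem hartogs_alg {A K : Type*} [CommRing A] [IsDomain A] [IsNoetherianRing A]
    [IsIntegrallyClosed A] [CommRing K] [Algebra A K] [IsFractionRing A K] (σ : K)
    (h : ∀ p : Ideal A, p.IsPrime → p.height ≤ 1 →
      ∃ b, b ∉ p ∧ ∃ a, algebraMap A K b * σ = algebraMap A K a) :
    ∃ a, algebraMap A K a = σ := by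
  have : IsDomain K := IsFractionRing.isDomain A
  by_contra hσ
  let N : Submodule A K := LinearMap.range (Algebra.linearMap A K)
  have hx : N.mkQ σ ≠ 0 := by
    intro h0
    rw [Submodule.mkQ_apply, Submodule.Quotient.mk_eq_zero] at h0
    obtain ⟨a, ha⟩ := h0
    exact hσ ⟨a, ha⟩
  obtain ⟨P, hP, hle⟩ := exists_le_isAssociatedPrime_of_isNoetherianRing A _ hx
  rw [isAssociatedPrime_iff] at hP
  obtain ⟨hPp, y, hy⟩ := hP
  obtain ⟨τ, rfl⟩ := N.mkQ_surjective y
  have key : ∀ (ρ : K) (b : A), b ∈ (⊥ : Submodule A (K ⧸ N)).colon {N.mkQ ρ} ↔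
      ∃ a, algebraMap A K a = algebraMap A K b * ρ := by
    intro ρ b
    rw [Submodule.mem_colon_singleton, Submodule.mem_bot, ← map_smul, Submodule.mkQ_apply,
      Submodule.Quotient.mk_eq_zero, Algebra.smul_def]
    rfl
  suffices hh : P.height ≤ 1 by
    obtain ⟨b, hb, a, ha⟩ := h P hPp hh
    exact hb (hle ((key _ _).2 ⟨a, ha.symm⟩))
  have hmem : ∀ b, b ∈ P ↔ ∃ a, algebraMap A K a = algebraMap A K b * τ := by
    intro b; rw [hy]; exact key τ b
  have hinj := IsFractionRing.injective A K
  by_cases hbot : P = ⊥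
  · subst hbot; simp
  by_cases hc : ∃ t ∈ P, ∃ u, u ∉ P ∧ algebraMap A K u = algebraMap A K t * τ
  · obtain ⟨t, ht, u, hu, hut⟩ := hc
    refine Ideal.height_le_one_of_isPrincipal_of_mem_minimalPrimes (Ideal.span {t}) P ⟨⟨hPp, ?_⟩, ?_⟩
    · simpa using ht
    · rintro q ⟨hq, htq⟩ hqP a ha
      obtain ⟨a', ha'⟩ := (hmem a).1 ha
      have e : a * u = a' * t := by
        apply hinj
        rw [map_mul, map_mul, hut, ha']; ring
      have : a * u ∈ q := by
        rw [e]; exact q.mul_mem_left _ (htq (Ideal.mem_span_singleton_self t))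
      exact (hq.mem_or_mem this).resolve_right (fun h' => hu (hqP h'))
  · exfalso
    push Not at hc
    have hint : IsIntegral A τ := by
      refine isIntegral_of_smul_mem_submodule (Submodule.map (Algebra.linearMap A K) P) ?_ ?_ τ ?_
      · rw [Submodule.ne_bot_iff]
        obtain ⟨a, ha, ha0⟩ := (Submodule.ne_bot_iff _).1 hbot
        exact ⟨_, ⟨a, ha, rfl⟩, fun h0 => ha0 (hinj (by simpa using h0))⟩
      · exact (IsNoetherian.noetherian P).map _
      · rintro _ ⟨t, ht, rfl⟩
        obtain ⟨a, ha⟩ := (hmem t).1 ht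
        refine ⟨a, ?_, ?_⟩
        · by_contra haP
          exact hc t ht a haP ha
        · simp only [Algebra.linearMap_apply, smul_eq_mul]
          rw [ha, mul_comm]
    obtain ⟨a, ha⟩ := IsIntegrallyClosed.algebraMap_eq_of_integral hint
    exact hPp.ne_top ((Ideal.eq_top_iff_one _).2 ((hmem 1).2 ⟨a, by simp [ha]⟩))

theorem two_le_coheight_pt (X : Scheme.{u}) (U : X.Opens)
    (hZ : hasEverywhereCodimAtLeastTwo ((U : Set X)ᶜ)) (y : X) (hy : y ∉ U) :
    2 ≤ Order.coheight y := by
  let Y := irreducibleComponent y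
  let y' : Y := ⟨y, mem_irreducibleComponent⟩
  let C : IrreducibleCloseds Y := ⟨closure {y'}, isIrreducible_singleton.closure, isClosed_closure⟩
  have hC : (C : Set Y) ⊆ Subtype.val ⁻¹' ((U : Set X)ᶜ) := by
    refine closure_minimal ?_ (U.2.isClosed_compl.preimage continuous_subtype_val)
    simpa using hy
  refine (hZ Y (irreducibleComponent_mem_irreducibleComponents y) C hC).trans ?_
  refine (Order.coheight_le_coheight_apply_of_strictMono _
    (IrreducibleCloseds.map_strictMono_of_isInducing Topology.IsInducing.subtypeVal) C).trans ?_
  rw [← Order.coheight_orderIso (irreducibleSetEquivPoints (α := X)).symm y]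
  apply le_of_eq
  congr 1
  apply IrreducibleCloseds.ext
  rw [coe_irreducibleEquivPoints_symm_apply]
  change closure (Subtype.val '' (closure {y'})) = _
  rw [closure_image_closure continuous_subtype_val]
  simp [y']

theorem coheight_fromSpecStalk (X : Scheme.{u}) (x : X) (p : Spec (X.presheaf.stalk x)) :
    p.asIdeal.height = Order.coheight (X.fromSpecStalk x p) := by
  rw [idealHeight_eq_coheight]
  have he := (X.fromSpecStalk x).isEmbedding
  have hle : ∀ a b : Spec (X.presheaf.stalk x), X.fromSpecStalk x a ≤ X.fromSpecStalk x b ↔ a ≤ b := by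
    intro a b
    exact he.isInducing.specializes_iff
  refine Order.coheight_eq_of_strictMono (X.fromSpecStalk x) ?_ ?_ p
  · intro a b hab
    rw [lt_iff_le_not_ge] at hab ⊢
    rwa [hle, hle]
  · intro a b hab
    have hb : b ∈ Set.range (X.fromSpecStalk x) := by
      rw [Scheme.range_fromSpecStalk]
      have h1 : b ⤳ X.fromSpecStalk x a := hab.le
      have h2 : X.fromSpecStalk x a ∈ Set.range (X.fromSpecStalk x) := ⟨a, rfl⟩
      rw [Scheme.range_fromSpecStalk] at h2
      exact h1.trans h2
    obtain ⟨c, rfl⟩ := hb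
    refine ⟨c, ?_, rfl⟩
    rw [lt_iff_le_not_ge] at hab ⊢
    rwa [hle, hle] at hab

theorem mem_U_of_height (X : Scheme.{u}) (U : X.Opens)
    (hZ : hasEverywhereCodimAtLeastTwo ((U : Set X)ᶜ)) (x : X)
    (p : Spec (X.presheaf.stalk x)) (hp : p.asIdeal.height ≤ 1) : X.fromSpecStalk x p ∈ U := by
  by_contra h
  have := two_le_coheight_pt X U hZ _ h
  rw [← coheight_fromSpecStalk] at this
  exact absurd (this.trans hp) (by decide)

theorem fromSpecStalk_specializes (X : Scheme.{u}) (x : X) (p : Spec (X.presheaf.stalk x)) :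
    X.fromSpecStalk x p ⤳ x := by
  have h2 : X.fromSpecStalk x p ∈ Set.range (X.fromSpecStalk x) := ⟨p, rfl⟩
  rwa [Scheme.range_fromSpecStalk] at h2

theorem isUnit_iff_not_mem (X : Scheme.{u}) (x : X) (p : Spec (X.presheaf.stalk x))
    (b : X.presheaf.stalk x) :
    IsUnit ((X.presheaf.stalkSpecializes (fromSpecStalk_specializes X x p)).hom b) ↔
      b ∉ p.asIdeal := by
  set h := fromSpecStalk_specializes X x p
  have e : Spec.map (X.presheaf.stalkSpecializes h) (IsLocalRing.closedPoint _) = p := by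
    apply (X.fromSpecStalk x).isEmbedding.injective
    have e1 := congr($(Scheme.SpecMap_stalkSpecializes_fromSpecStalk h)
      (IsLocalRing.closedPoint (X.presheaf.stalk (X.fromSpecStalk x p))))
    exact e1.trans Scheme.fromSpecStalk_closedPoint
  have e' := congr(b ∈ ($e).asIdeal)
  rw [← e', ← not_iff_not, not_not]
  exact (IsLocalRing.mem_maximalIdeal _).symm

theorem exists_frac (X : Scheme.{u}) {x y : X} (h : y ⤳ x) (g : X.presheaf.stalk y) :
    ∃ a b : X.presheaf.stalk x, IsUnit ((X.presheaf.stalkSpecializes h).hom b) ∧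
      (X.presheaf.stalkSpecializes h).hom b * g = (X.presheaf.stalkSpecializes h).hom a := by
  obtain ⟨_, ⟨W, hW, rfl⟩, hxW, -⟩ :=
    X.isBasis_affineOpens.exists_subset_of_mem_open (Set.mem_univ x) isOpen_univ
  have hyW : y ∈ W := h.mem_open W.2 hxW
  let _ : Algebra Γ(X, W) (X.presheaf.stalk y) := (X.presheaf.germ W y hyW).hom.toAlgebra
  have := hW.isLocalization_stalk ⟨y, hyW⟩
  obtain ⟨⟨r, s⟩, hrs⟩ := IsLocalization.surj (M := (hW.primeIdealOf ⟨y, hyW⟩).asIdeal.primeCompl) g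
  have hu := IsLocalization.map_units (X.presheaf.stalk y) s
  have hg : ∀ r : Γ(X, W), (X.presheaf.stalkSpecializes h).hom ((X.presheaf.germ W x hxW).hom r) =
      algebraMap _ (X.presheaf.stalk y) r := by
    intro r
    exact congr($(X.presheaf.germ_stalkSpecializes hxW h).hom r)
  refine ⟨(X.presheaf.germ W x hxW).hom r, (X.presheaf.germ W x hxW).hom s, ?_, ?_⟩
  · rwa [hg]
  · rw [hg, hg, mul_comm]; exact hrs

theorem spec_inj (X : Scheme.{u}) {x y : X} (h : y ⤳ x) (hd : IsDomain (X.presheaf.stalk x)) :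
    Function.Injective (X.presheaf.stalkSpecializes h).hom := by
  obtain ⟨_, ⟨W, hW, rfl⟩, hxW, -⟩ :=
    X.isBasis_affineOpens.exists_subset_of_mem_open (Set.mem_univ x) isOpen_univ
  have hyW : y ∈ W := h.mem_open W.2 hxW
  have hg : ∀ r : Γ(X, W), (X.presheaf.stalkSpecializes h).hom ((X.presheaf.germ W x hxW).hom r) =
      (X.presheaf.germ W y hyW).hom r := by
    intro r
    exact congr($(X.presheaf.germ_stalkSpecializes hxW h).hom r)
  rw [injective_iff_map_eq_zero]
  intro a ha
  obtain ⟨r, s, hs, hrs⟩ : ∃ r s : Γ(X, W), IsUnit ((X.presheaf.germ W x hxW).hom s) ∧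
      (X.presheaf.germ W x hxW).hom r = a * (X.presheaf.germ W x hxW).hom s := by
    let _ : Algebra Γ(X, W) (X.presheaf.stalk x) := (X.presheaf.germ W x hxW).hom.toAlgebra
    have := hW.isLocalization_stalk ⟨x, hxW⟩
    obtain ⟨⟨r, s⟩, hrs⟩ :=
      IsLocalization.surj (M := (hW.primeIdealOf ⟨x, hxW⟩).asIdeal.primeCompl) a
    exact ⟨r, s, IsLocalization.map_units (X.presheaf.stalk x) s, hrs.symm⟩
  have h0 : (X.presheaf.germ W y hyW).hom r = 0 := by
    rw [← hg, hrs, map_mul, ha, zero_mul]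
  obtain ⟨c, hc, hcr⟩ : ∃ c : Γ(X, W), IsUnit ((X.presheaf.germ W y hyW).hom c) ∧ c * r = 0 := by
    let _ : Algebra Γ(X, W) (X.presheaf.stalk y) := (X.presheaf.germ W y hyW).hom.toAlgebra
    have := hW.isLocalization_stalk ⟨y, hyW⟩
    obtain ⟨c, hc⟩ := (IsLocalization.map_eq_zero_iff
      (hW.primeIdealOf ⟨y, hyW⟩).asIdeal.primeCompl (X.presheaf.stalk y) r).1 h0
    exact ⟨c, IsLocalization.map_units (X.presheaf.stalk y) c, hc⟩
  have h1 : (X.presheaf.germ W x hxW).hom c * (X.presheaf.germ W x hxW).hom r = 0 := by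
    rw [← map_mul, hcr, map_zero]
  have hc0 : (X.presheaf.germ W x hxW).hom c ≠ 0 := by
    intro h'
    rw [← hg, h', map_zero] at hc
    exact not_isUnit_zero hc
  have hr0 := (mul_eq_zero.1 h1).resolve_left hc0
  rw [hrs] at hr0
  exact (mul_eq_zero.1 hr0).resolve_right hs.ne_zero

theorem germ_spec (X : Scheme.{u}) {x y : X} (h : y ⤳ x) {W : X.Opens} (hx : x ∈ W) (hy : y ∈ W)
    (r : Γ(X, W)) : (X.presheaf.stalkSpecializes h).hom ((X.presheaf.germ W x hx).hom r) =
      (X.presheaf.germ W y hy).hom r :=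
  congr($(X.presheaf.germ_stalkSpecializes hx h).hom r)

theorem germ_restrict (X : Scheme.{u}) {V W : X.Opens} (i : W ⟶ V) {x : X} (hx : x ∈ W)
    (r : Γ(X, V)) : (X.presheaf.germ W x hx).hom ((X.presheaf.map i.op).hom r) =
      (X.presheaf.germ V x (i.le hx)).hom r :=
  congr($(X.presheaf.germ_res i x hx).hom r)

theorem sec_ext (X : Scheme.{u}) (hX : IsNormalScheme X) (U : X.Opens)
    (hZ : hasEverywhereCodimAtLeastTwo ((U : Set X)ᶜ)) {W : X.Opens} (a b : Γ(X, W))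
    (h : ∀ y ∈ U, ∀ hy : y ∈ W, (X.presheaf.germ W y hy).hom a = (X.presheaf.germ W y hy).hom b) :
    a = b := by
  apply TopCat.Presheaf.section_ext X.sheaf W
  intro z hz
  have hd := (hX z).1
  let p : Spec (X.presheaf.stalk z) := ⟨⊥, Ideal.isPrime_bot⟩
  have hs := fromSpecStalk_specializes X z p
  have hU := mem_U_of_height X U hZ z p (by simp [p])
  have hW := hs.mem_open W.2 hz
  apply spec_inj X hs hd
  have := h _ hU hW
  rw [← germ_spec X hs hz hW, ← germ_spec X hs hz hW] at this
  exact this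

theorem local_ext (X : Scheme.{u}) [IsLocallyNoetherian X] (hX : IsNormalScheme X) (U : X.Opens)
    (hZ : hasEverywhereCodimAtLeastTwo ((U : Set X)ᶜ)) (V : X.Opens) (s : Γ(X, U ⊓ V))
    (x : X) (hxV : x ∈ V) : ∃ W : X.Opens, x ∈ W ∧ W ≤ V ∧ ∃ t : Γ(X, W),
      ∀ z (hzU : z ∈ U ⊓ V) (hz : z ∈ W),
        (X.presheaf.germ W z hz).hom t = (X.presheaf.germ (U ⊓ V) z hzU).hom s := by
  have hd := (hX x).1
  have hic := (hX x).2
  let p : Spec (X.presheaf.stalk x) := ⟨⊥, Ideal.isPrime_bot⟩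
  have hs := fromSpecStalk_specializes X x p
  have hU := mem_U_of_height X U hZ x p (by simp [p])
  have hunit : ∀ b, IsUnit ((X.presheaf.stalkSpecializes hs).hom b) ↔ b ∉ p.asIdeal :=
    isUnit_iff_not_mem X x p
  have hgen : ∀ q : Spec (X.presheaf.stalk x), X.fromSpecStalk x p ⤳ X.fromSpecStalk x q := by
    intro q
    refine Specializes.map ?_ (X.fromSpecStalk x).continuous
    exact (PrimeSpectrum.le_iff_specializes p q).1 (show (⊥ : Ideal _) ≤ q.asIdeal from bot_le)
  generalize X.fromSpecStalk x p = η at hs hU hunit hgen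
  have hηV : η ∈ V := hs.mem_open V.2 hxV
  let _ : Algebra (X.presheaf.stalk x) (X.presheaf.stalk η) :=
    (X.presheaf.stalkSpecializes hs).hom.toAlgebra
  have hfrac : IsFractionRing (X.presheaf.stalk x) (X.presheaf.stalk η) := by
    refine ⟨?_, ?_, ?_⟩
    · rintro ⟨b, hb⟩
      exact (hunit b).2 (nonZeroDivisors.ne_zero hb)
    · intro g
      obtain ⟨a, b, hb, hab⟩ := exists_frac X hs g
      refine ⟨⟨a, ⟨b, mem_nonZeroDivisors_of_ne_zero ((hunit b).1 hb)⟩⟩, ?_⟩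
      rw [mul_comm]; exact hab
    · intro a b hab
      exact ⟨1, by rw [spec_inj X hs hd hab]⟩
  obtain ⟨a, ha⟩ := hartogs_alg (A := X.presheaf.stalk x)
    ((X.presheaf.germ (U ⊓ V) η ⟨hU, hηV⟩).hom s) (by
      intro q hq hq1
      let q' : Spec (X.presheaf.stalk x) := ⟨q, hq⟩
      have hqs := fromSpecStalk_specializes X x q'
      have hqU := mem_U_of_height X U hZ x q' hq1
      have hqV := hqs.mem_open V.2 hxV
      obtain ⟨a, b, hb, hab⟩ := exists_frac X hqs ((X.presheaf.germ (U ⊓ V) _ ⟨hqU, hqV⟩).hom s)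
      refine ⟨b, (isUnit_iff_not_mem X x q' b).1 hb, a, ?_⟩
      have hηq : η ⤳ X.fromSpecStalk x q' := hgen q'
      have := congr((X.presheaf.stalkSpecializes hηq).hom $hab)
      rw [map_mul, germ_spec X hηq (W := U ⊓ V) ⟨hqU, hqV⟩ ⟨hU, hηV⟩] at this
      have hcomp : ∀ c, (X.presheaf.stalkSpecializes hηq).hom
          ((X.presheaf.stalkSpecializes hqs).hom c) = (X.presheaf.stalkSpecializes hs).hom c := by
        intro c
        exact congr($(X.presheaf.stalkSpecializes_comp hηq hqs).hom c)
      rw [hcomp, hcomp] at this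
      exact this)
  obtain ⟨W₁, hxW₁, t, ht⟩ := X.presheaf.exists_germ_eq a
  obtain ⟨W, hxW, hW, hWle, hWinj⟩ := X.exists_le_and_germ_injective x (W₁ ⊓ V) ⟨hxW₁, hxV⟩
  have hηW : η ∈ W := hs.mem_open W.2 hxW
  refine ⟨W, hxW, hWle.trans inf_le_right,
    (X.presheaf.map (homOfLE (hWle.trans inf_le_left)).op).hom t, ?_⟩
  intro z hzU hz
  have hηz : η ⤳ z := by
    rw [specializes_iff_forall_open]
    intro O hO hzO
    obtain ⟨f, hf, hzf⟩ := hW.exists_basicOpen_le (V := ⟨O, hO⟩) ⟨z, hzO⟩ hz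
    apply hf
    rw [X.mem_basicOpen _ _ hηW]
    rw [← germ_spec X hs hxW hηW]
    refine (hunit _).2 ?_
    intro h0
    have h0' : (X.presheaf.germ W x hxW).hom f = 0 := h0
    have : f = 0 := hWinj (h0'.trans (map_zero _).symm)
    subst this
    simp at hzf
  apply spec_inj X hηz (hX z).1
  rw [germ_spec X hηz (W := U ⊓ V) hzU ⟨hU, hηV⟩, germ_spec X hηz hz hηW, ← ha, ← germ_spec X hs hxW hηW,
    germ_restrict]
  exact congrArg _ ht

/-- algebraic Hartogs principle.  Let `X` be a normal locally noetherian
scheme, `U` an open subscheme whose complement `Z = X ∖ U` has everywhere codimension at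
least `2` in `X`, and `i : U → X` the inclusion.  Then the canonical morphism
`O_X → i_* O_U` is an isomorphism; equivalently, for every open `V ⊆ X` the restriction map
`O_X(V) → O_U(U ∩ V)` is bijective, i.e. every regular function on `U ∩ V` extends uniquely
to a regular function on `V`. -/
theorem structure_sheaf_pushforward_unit_bijective
    (X : Scheme.{u}) [IsLocallyNoetherian X] (hXnormal : IsNormalScheme X)
    (U : X.Opens) (hZ : hasEverywhereCodimAtLeastTwo ((U : Set X)ᶜ)) :
    ∀ V : X.Opens,
      Function.Bijective (X.presheaf.map (homOfLE (inf_le_right : U ⊓ V ≤ V)).op) := by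
  intro V
  constructor
  · intro a b hab
    apply sec_ext X hXnormal U hZ
    intro y hyU hyV
    have := congr((X.presheaf.germ (U ⊓ V) y ⟨hyU, hyV⟩).hom $hab)
    exact ((germ_restrict X _ _ a).symm.trans this).trans (germ_restrict X _ _ b)
  · intro s
    choose W hxW hWV t ht using fun x : V => local_ext X hXnormal U hZ V s x.1 x.2
    obtain ⟨r, hr, -⟩ := X.sheaf.existsUnique_gluing' W V (fun x => homOfLE (hWV x))
      (fun x hx => Opens.mem_iSup.2 ⟨⟨x, hx⟩, hxW _⟩) t (by
        intro i j
        apply sec_ext X hXnormal U hZ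
        intro y hyU hy
        refine ((germ_restrict X (Opens.infLELeft (W i) (W j)) hy (t i)).trans ?_).trans
          (germ_restrict X (Opens.infLERight (W i) (W j)) hy (t j)).symm
        rw [ht i y ⟨hyU, hWV i hy.1⟩, ht j y ⟨hyU, hWV i hy.1⟩])
    refine ⟨r, ?_⟩
    apply sec_ext X hXnormal U hZ
    intro y hyU hy
    refine (germ_restrict X _ hy r).trans ?_
    rw [← ht ⟨y, hy.2⟩ y hy (hxW _), ← hr ⟨y, hy.2⟩]
    exact (germ_restrict X (homOfLE (hWV ⟨y, hy.2⟩)) (hxW ⟨y, hy.2⟩) r).symm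
end

section
/- Let k be a field, let V and W be k-vector spaces with V finite-dimensional, and let T be a set of k-linear endomorphisms acting both on V and on W (i.e., for each t ∈ T one is given endomorphisms t_V of V and t_W of W), such that the endomorphisms t_V (t ∈ T) pairwise commute. Let f : V → W be a surjective k-linear map that is equivariant: f ∘ t_V = t_W ∘ f for all t ∈ T. Suppose there exist a nonzero w ∈ W and a function Φ : T → k with t_W(w) = Φ(t)·w for all t ∈ T. Then there exists a nonzero v ∈ V with t_V(v) = Φ(t)·v for all t ∈ T. -/
/-- Let `k` be a field, `V`, `W` two `k`-vector spaces with `V`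
finite-dimensional, and let `T` index a family of `k`-linear endomorphisms acting both on `V`
(via `tV`) and on `W` (via `tW`), such that the endomorphisms `tV t` pairwise commute.
If `f : V → W` is a surjective equivariant `k`-linear map and `W` contains a nonzero common
eigenvector `w` with eigensystem `Φ : T → k`, then `V` contains a nonzero common eigenvector
with the same eigensystem `Φ`. -/
theorem eigensystem_lift_of_surjective_equivariant
    {k : Type*} [Field k] {V W : Type*}
    [AddCommGroup V] [Module k V] [AddCommGroup W] [Module k W]
    [FiniteDimensional k V]
    {T : Type*} (tV : T → Module.End k V) (tW : T → Module.End k W)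
    (hcomm : ∀ s t : T, Commute (tV s) (tV t))
    (f : V →ₗ[k] W) (hsurj : Function.Surjective f)
    (hequiv : ∀ t : T, f ∘ₗ tV t = tW t ∘ₗ f)
    (w : W) (hw : w ≠ 0) (Φ : T → k) (hΦ : ∀ t : T, tW t w = Φ t • w) :
    ∃ v : V, v ≠ 0 ∧ ∀ t : T, tV t v = Φ t • v := by
  classical
  let N : T → Module.End k V := fun t => tV t - algebraMap k _ (Φ t)
  have hNa : ∀ t x, N t x = tV t x - Φ t • x := fun t x => by
    simp [N, Module.algebraMap_end_apply]
  have hNc : ∀ s t, Commute (N s) (N t) := fun s t =>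
    ((hcomm s t).sub_left (Algebra.commutes _ _)).sub_right
      (((Algebra.commutes _ _ : Commute (algebraMap k _ (Φ t)) (N s))).symm)
  have hfN : ∀ t x, f (N t x) = tW t (f x) - Φ t • f x := fun t x => by
    have := LinearMap.congr_fun (hequiv t) x
    simp only [LinearMap.comp_apply] at this
    rw [hNa, map_sub, map_smul, this]
  let S : Set (Submodule k V) := {U | (∀ s, ∀ x ∈ U, N s x ∈ U) ∧ ∃ u ∈ U, f u = w}
  have hSne : S.Nonempty := by
    obtain ⟨u, hu⟩ := hsurj w
    exact ⟨⊤, fun _ _ _ => trivial, u, trivial, hu⟩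
  obtain ⟨U, ⟨hUi, u, huU, huw⟩, hUmin⟩ := WellFounded.has_min (wellFounded_lt) S hSne
  have hpow : ∀ (P : Submodule k V) (t : T), (∀ x ∈ P, N t x ∈ P) →
      ∀ n : ℕ, ∀ x ∈ P, (N t ^ n) x ∈ P := by
    intro P t hP n
    induction n with
    | zero => intro x hx; simpa using hx
    | succ n ih => intro x hx; rw [pow_succ', Module.End.mul_apply]; exact hP _ (ih x hx)
  have hker : ∀ (t : T) (n : ℕ) (s : T) (x : V), (N t ^ n) x = 0 → (N t ^ n) (N s x) = 0 := by
    intro t n s x hx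
    have h := ((hNc t s).pow_left n).eq
    rw [← Module.End.mul_apply, h, Module.End.mul_apply, hx, map_zero]
  have hnil : ∀ t, ∃ n : ℕ, ∀ x ∈ U, (N t ^ n) x = 0 := by
    intro t
    let K : Submodule k V := U ⊓ LinearMap.ker f
    have hK : ∀ x ∈ K, N t x ∈ K := fun x hx => by
      refine ⟨hUi t x hx.1, ?_⟩
      have h0 : f x = 0 := hx.2
      simp [LinearMap.mem_ker, hfN, h0]
    have hNu : N t u ∈ K := ⟨hUi t u huU, by simp [LinearMap.mem_ker, hfN, huw, hΦ]⟩
    have hanti : Antitone fun n : ℕ => K.map (N t ^ n) := by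
      refine antitone_nat_of_succ_le fun n => ?_
      rintro _ ⟨x, hx, rfl⟩
      exact ⟨N t x, hK x hx, by rw [pow_succ, Module.End.mul_apply]⟩
    obtain ⟨n, hn⟩ := IsArtinian.monotone_stabilizes ⟨fun n => OrderDual.toDual (K.map (N t ^ n)), hanti⟩
    have hn1 : K.map (N t ^ n) = K.map (N t ^ (n+1)) := hn (n+1) (Nat.le_succ n)
    have hmem : (N t ^ (n+1)) u ∈ K.map (N t ^ n) :=
      ⟨N t u, hNu, by rw [pow_succ, Module.End.mul_apply]⟩
    rw [hn1] at hmem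
    obtain ⟨x, hx, hxu⟩ := hmem
    refine ⟨n+1, ?_⟩
    by_contra hcon
    push Not at hcon
    obtain ⟨y, hyU, hy⟩ := hcon
    refine hUmin (U ⊓ LinearMap.ker (N t ^ (n+1))) ⟨?_, u - x, ⟨U.sub_mem huU hx.1, ?_⟩, ?_⟩ ?_
    · intro s z hz
      exact ⟨hUi s z hz.1, hker t _ s z hz.2⟩
    · show (N t ^ (n+1)) (u - x) = 0
      rw [map_sub, hxu, sub_self]
    · have h0 : f x = 0 := hx.2
      rw [map_sub, huw, h0, sub_zero]
    · refine lt_of_le_of_ne inf_le_left fun h => hy ?_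
      rw [← h] at hyU
      exact hyU.2
  let S' : Set (Submodule k V) := {P | (∀ s, ∀ x ∈ P, N s x ∈ P) ∧ P ≤ U ∧ P ≠ ⊥}
  have hS' : S'.Nonempty := by
    refine ⟨U, hUi, le_rfl, ?_⟩
    rintro rfl
    rw [Submodule.mem_bot] at huU
    exact hw (by rw [← huw, huU, map_zero])
  obtain ⟨P, ⟨hPi, hPU, hP0⟩, hPmin⟩ := WellFounded.has_min (wellFounded_lt) S' hS'
  obtain ⟨v, hvP, hv0⟩ := Submodule.exists_mem_ne_zero_of_ne_bot hP0
  refine ⟨v, hv0, fun t => ?_⟩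
  rw [← sub_eq_zero, ← hNa]
  by_contra hvt
  obtain ⟨n, hn⟩ := hnil t
  have hex : ∃ n : ℕ, (N t ^ n) v = 0 := ⟨n, hn v (hPU hvP)⟩
  obtain ⟨m, hm, hm'⟩ : ∃ m : ℕ, (N t ^ m) v ≠ 0 ∧ (N t ^ (m+1)) v = 0 := by
    by_contra hcon
    push Not at hcon
    have : ∀ m : ℕ, (N t ^ m) v ≠ 0 := by
      intro m
      induction m with
      | zero => simpa using hv0
      | succ m ih => exact hcon m ih
    exact this n (hn v (hPU hvP))
  refine hPmin (P ⊓ LinearMap.ker (N t)) ⟨?_, inf_le_left.trans hPU, ?_⟩ ?_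
  · intro s x hx
    exact ⟨hPi s x hx.1, by simpa using hker t 1 s x (by simpa using hx.2)⟩
  · refine (Submodule.ne_bot_iff _).2 ⟨(N t ^ m) v, ⟨hpow P t (hPi t) m v hvP, ?_⟩, hm⟩
    show N t ((N t ^ m) v) = 0
    rw [← Module.End.mul_apply, ← pow_succ', hm']
  · refine lt_of_le_of_ne inf_le_left fun h => hvt ?_
    rw [← h] at hvP
    exact hvP.2
end
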